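/- Let β, μ > 0, let η satisfy 0 < η < min{1/β, 1/μ}, and let δ ∈ (0, 1), γ > 0. Suppose L : ℝ^m → ℝ is nonnegative, differentiable and β-smooth, and satisfies the μ-PL* condition on the closed ball B(w₀, R) with R ≥ η·√(2β)·√(L(w₀)) / (1 − √(1 − ηδμ/2)). Let (w_t)_{t≥0} be the δ-GClip iterates started at w₀, i.e. w_{t+1} = w_t − h(w_t)·∇L(w_t) with h(w) = η·min{1, max{δ, γ/‖∇L(w)‖}} (and h(w) = η when ∇L(w) = 0). Then for all t ≥ 0, w_t ∈ B(w₀, R) and L(w_t) ≤ L(w₀)·(1 − ηδμ/2)^t; moreover there exists a global minimizer w* ∈ B(w₀, R) of L with L(w*) = 0. -/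

import Mathlib

open Metric
open scoped RealInnerProductSpace Classical

/-- The δ-GClip step size `h(g) = η · min {1, max {δ, γ/‖g‖}}`, with the convention
that it equals `η` when `g = 0`. -/
noncomputable def deltaGClipStep {m : ℕ} (η γ δ : ℝ) (g : EuclideanSpace ℝ (Fin m)) : ℝ :=
  if g = 0 then η else η * min 1 (max δ (γ / ‖g‖))

section HelperLemmas

variable {m : ℕ}

lemma deltaGClipStep_le {η δ : ℝ} (γ : ℝ) (hη : 0 ≤ η) (g : EuclideanSpace ℝ (Fin m)) :
    deltaGClipStep η γ δ g ≤ η := by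
  unfold deltaGClipStep
  split_ifs
  · exact le_rfl
  · exact mul_le_of_le_one_right hη (min_le_left _ _)

lemma mul_le_deltaGClipStep {η δ : ℝ} (γ : ℝ) (hη : 0 ≤ η) (hδ : δ ≤ 1)
    (g : EuclideanSpace ℝ (Fin m)) : η * δ ≤ deltaGClipStep η γ δ g := by
  unfold deltaGClipStep
  split_ifs
  · exact mul_le_of_le_one_right hη hδ
  · exact mul_le_mul_of_nonneg_left (le_min hδ (le_max_left _ _)) hη

/-- A gradient step on a smooth function decreases the quadratic upper model. -/
lemma apply_gradient_step_le {L : EuclideanSpace ℝ (Fin m) → ℝ} {β : ℝ}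
    (hsmooth : ∀ x y, L y ≤ L x + ⟪gradient L x, y - x⟫ + β / 2 * ‖y - x‖ ^ 2)
    (x : EuclideanSpace ℝ (Fin m)) (h : ℝ) :
    L (x - h • gradient L x) ≤ L x - h * (1 - β * h / 2) * ‖gradient L x‖ ^ 2 := by
  have key := hsmooth x (x - h • gradient L x)
  rw [sub_sub_cancel_left, inner_neg_right, real_inner_smul_right, real_inner_self_eq_norm_sq,
    norm_neg, norm_smul, mul_pow, Real.norm_eq_abs, sq_abs] at key
  linarith

/-- A nonnegative smooth function controls the square of its gradient. -/
lemma norm_gradient_sq_le {L : EuclideanSpace ℝ (Fin m) → ℝ} {β : ℝ} (hβ : 0 < β)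
    (hL0 : ∀ x, 0 ≤ L x)
    (hsmooth : ∀ x y, L y ≤ L x + ⟪gradient L x, y - x⟫ + β / 2 * ‖y - x‖ ^ 2)
    (x : EuclideanSpace ℝ (Fin m)) : ‖gradient L x‖ ^ 2 ≤ 2 * β * L x := by
  have key := (hL0 _).trans (apply_gradient_step_le hsmooth x (1 / β))
  have hc : 1 / β * (1 - β * (1 / β) / 2) = 1 / (2 * β) := by
    field_simp
    norm_num
  rw [hc, one_div, inv_mul_eq_div, sub_nonneg, div_le_iff₀ (by positivity)] at key
  linarith

/-- A sequence whose steps are geometrically bounded stays close to its start. -/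
lemma dist_zero_le_of_le_geometric {E : Type*} [PseudoMetricSpace E] {u : ℕ → E} {C q : ℝ}
    (hq : q < 1) {n : ℕ} (hu : ∀ k < n, dist (u k) (u (k + 1)) ≤ C * q ^ k) :
    dist (u 0) (u n) ≤ C * (1 - q ^ n) / (1 - q) := by
  calc dist (u 0) (u n) ≤ ∑ k ∈ Finset.range n, C * q ^ k :=
        dist_le_range_sum_of_dist_le n fun {k} hk => hu k hk
    _ = C * (1 - q ^ n) / (1 - q) := by
        rw [← Finset.mul_sum, geom_sum_eq hq.ne, ← neg_div_neg_eq, neg_sub, neg_sub, mul_div_assoc]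

end HelperLemmas

/-- δ-GClip converges on smooth PL* functions.  If `L` is nonnegative,
differentiable, β-smooth and μ-PL* on `B(w₀, R)` with
`R ≥ η√(2β)√(L w₀) / (1 − √(1 − ηδμ/2))`, and `0 < η < min (1/β) (1/μ)`, `δ ∈ (0,1)`,
`γ > 0`, then the δ-GClip iterates stay in `B(w₀, R)` and satisfy
`L (w t) ≤ L w₀ · (1 − ηδμ/2)^t`; moreover there is a global minimizer
`w* ∈ B(w₀, R)` with `L w* = 0`. -/
theorem deltaGClip_converges_on_smooth_PLstar {m : ℕ}
    (L : EuclideanSpace ℝ (Fin m) → ℝ) (β μ η γ δ R : ℝ)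
    (hβ : 0 < β) (hμ : 0 < μ)
    (hη0 : 0 < η) (hη : η < min (1 / β) (1 / μ))
    (hδ0 : 0 < δ) (hδ1 : δ < 1) (hγ : 0 < γ)
    (hL0 : ∀ x, 0 ≤ L x) (hdiff : Differentiable ℝ L)
    (hsmooth : ∀ x y, L y ≤ L x + ⟪gradient L x, y - x⟫ + β / 2 * ‖y - x‖ ^ 2)
    (w₀ : EuclideanSpace ℝ (Fin m))
    (hR : η * Real.sqrt (2 * β) * Real.sqrt (L w₀) / (1 - Real.sqrt (1 - η * δ * μ / 2)) ≤ R)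
    (hPL : ∀ w ∈ closedBall w₀ R, μ * L w ≤ ‖gradient L w‖ ^ 2)
    (w : ℕ → EuclideanSpace ℝ (Fin m)) (hw0 : w 0 = w₀)
    (hupd : ∀ t, w (t + 1) =
      w t - deltaGClipStep η γ δ (gradient L (w t)) • gradient L (w t)) :
    (∀ t, w t ∈ closedBall w₀ R ∧ L (w t) ≤ L w₀ * (1 - η * δ * μ / 2) ^ t) ∧
      ∃ wstar ∈ closedBall w₀ R, L wstar = 0 ∧ ∀ v, L wstar ≤ L v := by
  have hηβ : β * η < 1 := by
    have := (lt_div_iff₀ hβ).1 (hη.trans_le (min_le_left _ _))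
    linarith
  have hημ : η * μ < 1 := (lt_div_iff₀ hμ).1 (hη.trans_le (min_le_right _ _))
  set r := 1 - η * δ * μ / 2 with hr
  have hr1 : r < 1 := by
    have : 0 < η * δ * μ := by positivity
    linarith
  have hr0 : 0 ≤ r := by
    have : η * μ * δ ≤ 1 := mul_le_one₀ hημ.le hδ0.le hδ1.le
    linarith
  set q := √r
  have hq0 : 0 ≤ q := Real.sqrt_nonneg r
  have hq1 : q < 1 := (Real.sqrt_lt' one_pos).2 (by simpa using hr1)
  have hq2 : q ^ 2 = r := Real.sq_sqrt hr0
  set C := η * √(2 * β) * √(L w₀)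
  have hC : 0 ≤ C := by positivity
  have hdecay : ∀ x ∈ closedBall w₀ R,
      L (x - deltaGClipStep η γ δ (gradient L x) • gradient L x) ≤ L x * r := by
    intro x hx
    have hle := deltaGClipStep_le (δ := δ) γ hη0.le (gradient L x)
    have hge := mul_le_deltaGClipStep γ hη0.le hδ1.le (gradient L x)
    refine (apply_gradient_step_le hsmooth x _).trans ?_
    set h := deltaGClipStep η γ δ (gradient L x)
    have hβh : β * h ≤ 1 := (mul_le_mul_of_nonneg_left hle hβ.le).trans hηβ.le
    have hcoef : η * δ / 2 ≤ h * (1 - β * h / 2) := by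
      have : 0 < η * δ := by positivity
      nlinarith
    have := mul_le_mul hcoef (hPL x hx) (mul_nonneg hμ.le (hL0 x))
      ((by positivity : (0 : ℝ) ≤ η * δ / 2).trans hcoef)
    rw [hr]
    linarith
  have hstep : ∀ t, L (w t) ≤ L w₀ * r ^ t → dist (w t) (w (t + 1)) ≤ C * q ^ t := by
    intro t ht
    have hge := mul_le_deltaGClipStep γ hη0.le hδ1.le (gradient L (w t))
    have hh0 := (mul_pos hη0 hδ0).le.trans hge
    rw [hupd, dist_eq_norm, sub_sub_cancel, norm_smul, Real.norm_of_nonneg hh0]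
    have hgrad : ‖gradient L (w t)‖ ≤ √(2 * β) * √(L w₀) * q ^ t := by
      refine (pow_le_pow_iff_left₀ (norm_nonneg _) (by positivity) two_ne_zero).1 ?_
      rw [mul_pow, mul_pow, Real.sq_sqrt (by positivity), Real.sq_sqrt (hL0 _), pow_right_comm,
        hq2, mul_assoc]
      exact (norm_gradient_sq_le hβ hL0 hsmooth _).trans
        (mul_le_mul_of_nonneg_left ht (by positivity))
    calc _ ≤ η * (√(2 * β) * √(L w₀) * q ^ t) :=
          mul_le_mul (deltaGClipStep_le γ hη0.le _) hgrad (norm_nonneg _) hη0.le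
      _ = C * q ^ t := by ring
  have hmain : ∀ t, w t ∈ closedBall w₀ R ∧ L (w t) ≤ L w₀ * r ^ t := by
    intro t
    induction t using Nat.strong_induction_on with
    | _ t ih =>
      constructor
      · rw [mem_closedBall, dist_comm, ← hw0]
        refine (dist_zero_le_of_le_geometric hq1 fun k hk => hstep k (ih k hk).2).trans
          (le_trans ?_ hR)
        have : 0 < 1 - q := sub_pos.2 hq1
        gcongr
        exact mul_le_of_le_one_right hC (sub_le_self _ (pow_nonneg hq0 t))
      · cases t with
        | zero => simp [hw0]
        | succ k =>
          obtain ⟨hk, hLk⟩ := ih k k.lt_succ_self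
          rw [hupd, pow_succ, ← mul_assoc]
          exact (hdecay _ hk).trans (mul_le_mul_of_nonneg_right hLk hr0)
  refine ⟨hmain, ?_⟩
  obtain ⟨z, hz⟩ := cauchySeq_tendsto_of_complete
    (cauchySeq_of_le_geometric q C hq1 fun t => hstep t (hmain t).2)
  have hLz : L z ≤ 0 := by
    have hlim := (tendsto_pow_atTop_nhds_zero_of_lt_one hr0 hr1).const_mul (L w₀)
    rw [mul_zero] at hlim
    exact le_of_tendsto_of_tendsto' ((hdiff.continuous.tendsto z).comp hz) hlim
      fun t => (hmain t).2
  exact ⟨z, isClosed_closedBall.mem_of_tendsto hz (.of_forall fun t => (hmain t).1),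
    hLz.antisymm (hL0 z), fun v => hLz.trans (hL0 v)⟩
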